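/- Let L be an n × n matrix with integer entries and determinant equal to ±1. Suppose L has an eigenvalue λ with 0 < λ < 1 whose eigenspace E = {x ∈ ℝ^n : Lx = λx} is one-dimensional, and suppose E has nonempty intersection with the interior of [0,1]^n. Set E' = E ∩ [0,1/2]^n (a nonempty closed subset of [0,1]^n). Then the semisimple n-generator MV-algebra McN(E') is not residually finite and is not hopfian: there exists a surjective MV-endomorphism of McN(E') that is not injective. -/

import Mathlib

open Set BigOperators

/-- The unit cube `[0,1]^n` as a subset of `Fin n → ℝ`. -/
def cube (n : ℕ) : Set (Fin n → ℝ) := Set.Icc 0 1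

/-- An (affine) linear polynomial with integer coefficients. -/
def IsAffineZ {n : ℕ} (p : (Fin n → ℝ) → ℝ) : Prop :=
  ∃ (m : ℤ) (c : Fin n → ℤ), ∀ x, p x = (m : ℝ) + ∑ i, (c i : ℝ) * x i

/-- A McNaughton function on `[0,1]^n`: continuous, `[0,1]`-valued, and agreeing at each
point of the cube with one of finitely many affine polynomials with integer coefficients. -/
def IsMcNaughton {n : ℕ} (f : (Fin n → ℝ) → ℝ) : Prop :=
  ContinuousOn f (cube n) ∧ (∀ x ∈ cube n, f x ∈ Set.Icc (0:ℝ) 1) ∧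
  ∃ (u : ℕ) (p : Fin u → (Fin n → ℝ) → ℝ),
    (∀ j, IsAffineZ (p j)) ∧ ∀ x ∈ cube n, ∃ j, f x = p j x

/-- `McN X`: restrictions to `X` of McNaughton functions on `[0,1]^n`. -/
def McN {n : ℕ} (X : Set (Fin n → ℝ)) : Set (↥X → ℝ) :=
  {g : ↥X → ℝ | ∃ f, IsMcNaughton (n := n) f ∧ ∀ x : X, g x = f x.1}

/-- Pointwise MV-negation `¬f = 1 - f`. -/
def mvNeg {α : Type*} (f : α → ℝ) : α → ℝ := fun x => 1 - f x

/-- Pointwise MV-sum `f ⊕ g = min(1, f + g)`. -/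
def mvOplus {α : Type*} (f g : α → ℝ) : α → ℝ := fun x => min 1 (f x + g x)

/-- A point all of whose coordinates are rational. -/
def IsRationalPoint {n : ℕ} (x : Fin n → ℝ) : Prop := ∀ i, ∃ q : ℚ, x i = (q : ℝ)

/-- An MV-endomorphism of `McN X`. -/
def IsMVEndo {n : ℕ} (X : Set (Fin n → ℝ)) (σ : (↥X → ℝ) → (↥X → ℝ)) : Prop :=
  Set.MapsTo σ (McN X) (McN X) ∧
  σ (fun _ => 0) = (fun _ => 0) ∧
  (∀ f ∈ McN X, σ (mvNeg f) = mvNeg (σ f)) ∧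
  (∀ f ∈ McN X, ∀ g ∈ McN X, σ (mvOplus f g) = mvOplus (σ f) (σ g))

/-- The finite MV-chain `C_d = {0, 1/d, …, 1}`. -/
def Cchain (d : ℕ) : Set ℝ := {y : ℝ | ∃ k : ℕ, k ≤ d ∧ y = (k : ℝ) / d}

/-- `McN X` is residually finite: distinct elements can be separated by a homomorphism
into some finite MV-chain `C_d`. -/
def ResiduallyFinite {n : ℕ} (X : Set (Fin n → ℝ)) : Prop :=
  ∀ f ∈ McN X, ∀ g ∈ McN X, f ≠ g →
    ∃ d : ℕ, 1 ≤ d ∧ ∃ σ : (↥X → ℝ) → ℝ,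
      (∀ h ∈ McN X, σ h ∈ Cchain d) ∧
      σ (fun _ => 0) = 0 ∧
      (∀ h ∈ McN X, σ (mvNeg h) = 1 - σ h) ∧
      (∀ h ∈ McN X, ∀ k ∈ McN X, σ (mvOplus h k) = min 1 (σ h + σ k)) ∧
      σ f ≠ σ g

/-- The eigenspace `E = {x ∈ ℝ^n : Lx = λx}` of an integer matrix `L`. -/
def eigSet {n : ℕ} (L : Matrix (Fin n) (Fin n) ℤ) (l : ℝ) : Set (Fin n → ℝ) :=
  {x : Fin n → ℝ | (L.map ((↑) : ℤ → ℝ)).mulVec x = l • x}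

/-- The cube `[0, 1/2]^n`. -/
def halfCube (n : ℕ) : Set (Fin n → ℝ) := Set.Icc 0 (fun _ => (1:ℝ)/2)

/-- Truncation of a real number to `[0,1]`. -/
def unitClamp (y : ℝ) : ℝ := max 0 (min 1 y)

lemma unitClamp_mem (y : ℝ) : unitClamp y ∈ Set.Icc (0 : ℝ) 1 :=
  ⟨le_max_left _ _, max_le zero_le_one (min_le_left _ _)⟩

lemma unitClamp_of_mem {y : ℝ} (hy : y ∈ Set.Icc (0 : ℝ) 1) : unitClamp y = y := by
  rw [unitClamp, min_eq_right hy.2, max_eq_right hy.1]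

lemma unitClamp_eq_zero_iff {y : ℝ} : unitClamp y = 0 ↔ y ≤ 0 := by
  unfold unitClamp
  grind

lemma one_sub_unitClamp (y : ℝ) : 1 - unitClamp y = unitClamp (1 - y) := by
  unfold unitClamp
  grind

lemma unitClamp_cases (y : ℝ) : unitClamp y = 0 ∨ unitClamp y = 1 ∨ unitClamp y = y := by
  unfold unitClamp
  grind

/-- Adding `x ∈ [0,1]` under a truncation is an MV-operation, namely
`(unitClamp y ⊕ x) ⊙ unitClamp (y + 1)` with `a ⊙ b = ¬(¬a ⊕ ¬b)`. -/
lemma unitClamp_add {x : ℝ} (hx : x ∈ Set.Icc (0 : ℝ) 1) (y : ℝ) :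
    unitClamp (y + x) =
      1 - min 1 ((1 - min 1 (unitClamp y + x)) + (1 - unitClamp (y + 1))) := by
  obtain ⟨h0, h1⟩ := hx
  unfold unitClamp
  grind

lemma continuous_unitClamp : Continuous unitClamp := by
  unfold unitClamp
  fun_prop

section McNaughton

variable {n : ℕ}

lemma isAffineZ_const (m : ℤ) : IsAffineZ (fun _ : Fin n → ℝ => (m : ℝ)) :=
  ⟨m, 0, fun x => by simp⟩

lemma isAffineZ_linear (c : Fin n → ℤ) :
    IsAffineZ (fun x : Fin n → ℝ => ∑ i, (c i : ℝ) * x i) :=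
  ⟨0, c, fun x => by simp⟩

lemma IsAffineZ.add {p q : (Fin n → ℝ) → ℝ} (hp : IsAffineZ p) (hq : IsAffineZ q) :
    IsAffineZ (fun x => p x + q x) := by
  obtain ⟨m, c, h⟩ := hp
  obtain ⟨m', c', h'⟩ := hq
  refine ⟨m + m', c + c', fun x => ?_⟩
  simp only [h, h', Pi.add_apply, Int.cast_add, add_mul, Finset.sum_add_distrib]
  ring

lemma IsAffineZ.const_mul {p : (Fin n → ℝ) → ℝ} (hp : IsAffineZ p) (a : ℤ) :
    IsAffineZ (fun x => (a : ℝ) * p x) := by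
  obtain ⟨m, c, h⟩ := hp
  refine ⟨a * m, fun i => a * c i, fun x => ?_⟩
  simp only [h, Int.cast_mul, mul_add, Finset.mul_sum, mul_assoc]

lemma IsAffineZ.sum {ι : Type*} (s : Finset ι) {p : ι → (Fin n → ℝ) → ℝ}
    (hp : ∀ i ∈ s, IsAffineZ (p i)) : IsAffineZ (fun x => ∑ i ∈ s, p i x) := by
  classical
  induction s using Finset.induction_on with
  | empty => simpa using isAffineZ_const (n := n) 0
  | insert a s ha ih =>
    simp only [Finset.sum_insert ha]
    exact (hp a (Finset.mem_insert_self a s)).add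
      (ih fun i hi => hp i (Finset.mem_insert_of_mem hi))

lemma IsAffineZ.comp {m : ℕ} {p : (Fin m → ℝ) → ℝ} (hp : IsAffineZ p)
    {q : Fin m → (Fin n → ℝ) → ℝ} (hq : ∀ i, IsAffineZ (q i)) :
    IsAffineZ (fun x => p (fun i => q i x)) := by
  obtain ⟨a, c, h⟩ := hp
  simp only [h]
  exact (isAffineZ_const a).add (IsAffineZ.sum _ fun i _ => (hq i).const_mul (c i))

lemma IsAffineZ.continuous {p : (Fin n → ℝ) → ℝ} (hp : IsAffineZ p) : Continuous p := by
  obtain ⟨m, c, h⟩ := hp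
  rw [funext h]
  fun_prop

lemma isMcNaughton_of_finite {ι : Type*} [Finite ι] {f : (Fin n → ℝ) → ℝ}
    (hf : ContinuousOn f (cube n)) (hf' : ∀ x ∈ cube n, f x ∈ Set.Icc (0 : ℝ) 1)
    (p : ι → (Fin n → ℝ) → ℝ) (hp : ∀ j, IsAffineZ (p j))
    (hfp : ∀ x ∈ cube n, ∃ j, f x = p j x) : IsMcNaughton f := by
  obtain ⟨u, ⟨e⟩⟩ := Finite.exists_equiv_fin ι
  refine ⟨hf, hf', u, fun j => p (e.symm j), fun j => hp _, fun x hx => ?_⟩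
  obtain ⟨j, hj⟩ := hfp x hx
  exact ⟨e j, by simpa using hj⟩

lemma IsAffineZ.isMcNaughton_unitClamp {p : (Fin n → ℝ) → ℝ} (hp : IsAffineZ p) :
    IsMcNaughton (fun x => unitClamp (p x)) := by
  refine isMcNaughton_of_finite (continuous_unitClamp.comp hp.continuous).continuousOn
    (fun x _ => unitClamp_mem _)
    (![fun _ => ((0 : ℤ) : ℝ), fun _ => ((1 : ℤ) : ℝ), p] : Fin 3 → (Fin n → ℝ) → ℝ) ?_ ?_
  · intro j
    fin_cases j
    · exact isAffineZ_const 0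
    · exact isAffineZ_const 1
    · exact hp
  · intro x _
    rcases unitClamp_cases (p x) with h | h | h
    · exact ⟨0, by simpa using h⟩
    · exact ⟨1, by simpa using h⟩
    · exact ⟨2, by simpa using h⟩

lemma IsMcNaughton.comp {m : ℕ} {f : (Fin m → ℝ) → ℝ} (hf : IsMcNaughton f)
    {g : Fin m → (Fin n → ℝ) → ℝ} (hg : ∀ i, IsMcNaughton (g i)) :
    IsMcNaughton (fun x => f (fun i => g i x)) := by
  obtain ⟨hfc, hfI, u, p, hp, hfp⟩ := hf
  have hmaps : ∀ x ∈ cube n, (fun i => g i x) ∈ cube m := fun x hx =>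
    ⟨fun i => ((hg i).2.1 x hx).1, fun i => ((hg i).2.1 x hx).2⟩
  choose hgc hgI w q hq hgq using hg
  refine isMcNaughton_of_finite (ι := Fin u × ∀ i, Fin (w i))
    (hfc.comp (continuousOn_pi.2 hgc) hmaps) (fun x hx => hfI _ (hmaps x hx))
    (fun j x => p j.1 (fun i => q i (j.2 i) x))
    (fun j => (hp j.1).comp fun i => hq i (j.2 i)) fun x hx => ?_
  obtain ⟨j, hj⟩ := hfp _ (hmaps x hx)
  choose k hk using fun i => hgq i x hx
  exact ⟨(j, k), hj.trans (by simp only [hk])⟩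

lemma IsMcNaughton.comp_matrix {f : (Fin n → ℝ) → ℝ} (hf : IsMcNaughton f)
    (A : Matrix (Fin n) (Fin n) ℤ) :
    IsMcNaughton
      (fun x => f (fun i => unitClamp ((A.map ((↑) : ℤ → ℝ)).mulVec x i))) :=
  hf.comp fun i => (isAffineZ_linear (A i)).isMcNaughton_unitClamp

lemma IsMcNaughton.neg {f : (Fin n → ℝ) → ℝ} (hf : IsMcNaughton f) :
    IsMcNaughton (mvNeg f) := by
  obtain ⟨hc, hI, u, p, hp, hfp⟩ := hf
  refine ⟨continuousOn_const.sub hc, fun x hx => ?_, u,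
    fun j x => ((1 : ℤ) : ℝ) + ((-1 : ℤ) : ℝ) * p j x,
    fun j => (isAffineZ_const 1).add ((hp j).const_mul (-1)), fun x hx => ?_⟩
  · have := hI x hx
    exact ⟨by simpa [mvNeg] using this.2, by simpa [mvNeg] using this.1⟩
  · obtain ⟨j, hj⟩ := hfp x hx
    exact ⟨j, by simp [mvNeg, hj, sub_eq_add_neg]⟩

lemma IsMcNaughton.oplus {f g : (Fin n → ℝ) → ℝ} (hf : IsMcNaughton f)
    (hg : IsMcNaughton g) : IsMcNaughton (mvOplus f g) := by
  obtain ⟨hc, hI, u, p, hp, hfp⟩ := hf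
  obtain ⟨hc', hI', u', p', hp', hfp'⟩ := hg
  refine isMcNaughton_of_finite (ι := Option (Fin u × Fin u'))
    (continuousOn_const.inf (hc.add hc')) (fun x hx => ?_)
    (fun j => j.elim (fun _ => ((1 : ℤ) : ℝ)) fun k x => p k.1 x + p' k.2 x) ?_ fun x hx => ?_
  · exact ⟨le_min zero_le_one (add_nonneg (hI x hx).1 (hI' x hx).1), min_le_left _ _⟩
  · rintro (_ | k)
    · exact isAffineZ_const 1
    · exact (hp k.1).add (hp' k.2)
  · rcases min_choice 1 (f x + g x) with h | h
    · exact ⟨none, by simpa [mvOplus] using h⟩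
    · obtain ⟨j, hj⟩ := hfp x hx
      obtain ⟨k, hk⟩ := hfp' x hx
      exact ⟨some (j, k), by simpa [mvOplus, ← hj, ← hk] using h⟩

variable {X : Set (Fin n → ℝ)}

lemma mvNeg_mem_McN {f : X → ℝ} (hf : f ∈ McN X) : mvNeg f ∈ McN X := by
  obtain ⟨F, hF, h⟩ := hf
  exact ⟨mvNeg F, hF.neg, fun x => by simp [mvNeg, h]⟩

lemma mvOplus_mem_McN {f g : X → ℝ} (hf : f ∈ McN X) (hg : g ∈ McN X) :
    mvOplus f g ∈ McN X := by
  obtain ⟨F, hF, h⟩ := hf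
  obtain ⟨G, hG, h'⟩ := hg
  exact ⟨mvOplus F G, hF.oplus hG, fun x => by simp [mvOplus, h, h']⟩

lemma IsAffineZ.unitClamp_mem_McN {p : (Fin n → ℝ) → ℝ} (hp : IsAffineZ p) :
    (fun x : X => unitClamp (p x)) ∈ McN X :=
  ⟨_, hp.isMcNaughton_unitClamp, fun _ => rfl⟩

lemma McN_mem_Icc (hX : X ⊆ cube n) {f : X → ℝ} (hf : f ∈ McN X) (x : X) :
    f x ∈ Set.Icc (0 : ℝ) 1 := by
  obtain ⟨F, hF, h⟩ := hf
  rw [h]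
  exact hF.2.1 _ (hX x.2)

lemma isAffineZ_eval (i : Fin n) : IsAffineZ (fun x : Fin n → ℝ => x i) := by
  simpa [Pi.single_apply] using isAffineZ_linear (n := n) (Pi.single i 1)

lemma eval_mem_McN (hX : X ⊆ cube n) (i : Fin n) : (fun x : X => x.1 i) ∈ McN X := by
  obtain ⟨F, hF, h⟩ := (isAffineZ_eval i).unitClamp_mem_McN (X := X)
  exact ⟨F, hF, fun x => (unitClamp_of_mem ⟨(hX x.2).1 i, (hX x.2).2 i⟩).symm.trans (h x)⟩

end McNaughton

section Homomorphisms

variable {n : ℕ} {X : Set (Fin n → ℝ)} {ρ : (X → ℝ) → ℝ}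

/-- A map `ρ` on `McN X` takes all truncations of integer translates of `g` to the corresponding
truncations of integer translates of `s`. -/
def SendsTruncations (ρ : (X → ℝ) → ℝ) (g : X → ℝ) (s : ℝ) : Prop :=
  ∀ m : ℤ, (fun x => unitClamp (g x + m)) ∈ McN X ∧
    ρ (fun x => unitClamp (g x + m)) = unitClamp (s + m)

/-- A map `ρ` is an MV-homomorphism from `McN X` to `[0,1]`. -/
structure IsMVCharacter (ρ : (X → ℝ) → ℝ) : Prop where
  mem_Icc : ∀ h ∈ McN X, ρ h ∈ Set.Icc (0 : ℝ) 1
  map_zero : ρ (fun _ => 0) = 0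
  map_neg : ∀ h ∈ McN X, ρ (mvNeg h) = 1 - ρ h
  map_oplus : ∀ h ∈ McN X, ∀ k ∈ McN X, ρ (mvOplus h k) = min 1 (ρ h + ρ k)

lemma zero_mem_McN : (fun _ => 0 : X → ℝ) ∈ McN X := by
  simpa [unitClamp] using (isAffineZ_const (n := n) 0).unitClamp_mem_McN (X := X)

lemma IsMVCharacter.sendsTruncations_zero (hρ : IsMVCharacter ρ) :
    SendsTruncations ρ (fun _ => 0) 0 := by
  intro m
  have hmem := (isAffineZ_const (n := n) m).unitClamp_mem_McN (X := X)
  simp only [zero_add]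
  refine ⟨hmem, ?_⟩
  rcases le_or_gt m 0 with h | h
  · have h0 : unitClamp (m : ℝ) = 0 := unitClamp_eq_zero_iff.2 (by exact_mod_cast h)
    simp only [h0]
    exact hρ.map_zero
  · have h1 : unitClamp (m : ℝ) = 1 := by
      have : (1 : ℝ) ≤ m := by exact_mod_cast h
      rw [unitClamp, min_eq_left this, max_eq_right zero_le_one]
    have hone : mvNeg (fun _ : X => (0 : ℝ)) = fun _ => 1 :=
      funext fun _ => sub_zero 1
    simp only [h1]
    rw [← hone, hρ.map_neg _ zero_mem_McN, hρ.map_zero, sub_zero]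

lemma SendsTruncations.neg (hρ : IsMVCharacter ρ) {g : X → ℝ} {s : ℝ}
    (hg : SendsTruncations ρ g s) : SendsTruncations ρ (fun x => -g x) (-s) := by
  intro m
  obtain ⟨hmem, hval⟩ := hg (1 - m)
  have key : (fun x => unitClamp (-g x + m)) =
      mvNeg (fun x => unitClamp (g x + (1 - m : ℤ))) := by
    funext x
    rw [mvNeg, one_sub_unitClamp]
    push_cast
    ring_nf
  rw [key]
  refine ⟨mvNeg_mem_McN hmem, ?_⟩
  rw [hρ.map_neg _ hmem, hval, one_sub_unitClamp]
  push_cast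
  ring_nf

lemma SendsTruncations.add (hρ : IsMVCharacter ρ) (hX : X ⊆ cube n) {g h : X → ℝ} {s : ℝ}
    (hg : SendsTruncations ρ g s) (hh : h ∈ McN X) :
    SendsTruncations ρ (fun x => g x + h x) (s + ρ h) := by
  intro m
  obtain ⟨hmem, hval⟩ := hg m
  obtain ⟨hmem', hval'⟩ := hg (m + 1)
  have key : (fun x => unitClamp (g x + h x + m)) =
      mvNeg (mvOplus (mvNeg (mvOplus (fun x => unitClamp (g x + m)) h))
        (mvNeg (fun x => unitClamp (g x + (m + 1 : ℤ))))) := by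
    funext x
    rw [add_right_comm, unitClamp_add (McN_mem_Icc hX hh x)]
    simp only [mvNeg, mvOplus, Int.cast_add, Int.cast_one, add_assoc]
  have h1 := mvOplus_mem_McN hmem hh
  have h2 := mvNeg_mem_McN h1
  have h3 := mvNeg_mem_McN hmem'
  have h4 := mvOplus_mem_McN h2 h3
  rw [key]
  refine ⟨mvNeg_mem_McN h4, ?_⟩
  rw [hρ.map_neg _ h4, hρ.map_oplus _ h2 _ h3, hρ.map_neg _ h1, hρ.map_neg _ hmem',
    hρ.map_oplus _ hmem _ hh, hval, hval', add_right_comm, unitClamp_add (hρ.mem_Icc _ hh)]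
  simp only [Int.cast_add, Int.cast_one, add_assoc]

lemma SendsTruncations.add_zsmul (hρ : IsMVCharacter ρ) (hX : X ⊆ cube n) {g h : X → ℝ}
    {s : ℝ} (hg : SendsTruncations ρ g s) (hh : h ∈ McN X) (a : ℤ) :
    SendsTruncations ρ (fun x => g x + a * h x) (s + a * ρ h) := by
  induction a using Int.induction_on with
  | zero => simpa using hg
  | succ i ih =>
    convert ih.add hρ hX hh using 1
    · funext x
      push_cast
      ring
    · push_cast
      ring
  | pred i ih =>
    convert ((ih.neg hρ).add hρ hX hh).neg hρ using 1
    · funext x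
      push_cast
      ring
    · push_cast
      ring

end Homomorphisms

/-- A nonzero vector, a multiple of which has integer entries, is not an eigenvector of an integer
matrix for an eigenvalue in `(0,1)`. -/
lemma eq_zero_of_mem_eigSet_of_int {n : ℕ} {L : Matrix (Fin n) (Fin n) ℤ} {l : ℝ} (hl0 : 0 < l)
    (hl1 : l < 1) {r : Fin n → ℝ} (hr : r ∈ eigSet L l) {d : ℝ} (hd : d ≠ 0)
    (hz : ∀ i, ∃ z : ℤ, d * r i = z) : r = 0 := by
  have hpow : ∀ k : ℕ, ∀ i, ∃ z : ℤ, l ^ k * (d * r i) = z := by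
    intro k
    induction k with
    | zero => simpa using hz
    | succ k ih =>
      intro i
      choose z hz' using ih
      refine ⟨∑ j, L i j * z j, ?_⟩
      have hi : ∑ j, (L i j : ℝ) * r j = l * r i := congrFun hr i
      push_cast
      simp only [← hz']
      calc l ^ (k + 1) * (d * r i) = l ^ k * d * (l * r i) := by ring
        _ = ∑ j, (L i j : ℝ) * (l ^ k * (d * r j)) := by
          rw [← hi, Finset.mul_sum]
          exact Finset.sum_congr rfl fun j _ => by ring
  funext i
  by_contra hi
  have hi' : d * r i ≠ 0 := mul_ne_zero hd hi
  obtain ⟨k, hk⟩ := exists_pow_lt_of_lt_one (inv_pos.2 (abs_pos.2 hi')) hl1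
  obtain ⟨z, hz'⟩ := hpow k i
  have hlt : |(z : ℝ)| < 1 := by
    rw [← hz', abs_mul, abs_of_pos (pow_pos hl0 k)]
    calc l ^ k * |d * r i| < |d * r i|⁻¹ * |d * r i| :=
          mul_lt_mul_of_pos_right hk (abs_pos.2 hi')
      _ = 1 := inv_mul_cancel₀ (abs_pos.2 hi').ne'
  have hz0 : z = 0 := by
    rw [← Int.abs_lt_one_iff]
    exact_mod_cast hlt
  rw [hz0, Int.cast_zero] at hz'
  exact mul_ne_zero (pow_pos hl0 k).ne' hi' hz'

/-- The slopes of a direction `u` and of a point `r ∈ [0,1]^n` satisfying all homogeneous integer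
inequalities in two variables that hold at `u` agree. -/
lemma mul_le_mul_of_int_inequalities {n : ℕ} {u r : Fin n → ℝ} (hu : ∀ i, 0 < u i)
    (hr : ∀ i, r i ∈ Set.Icc (0 : ℝ) 1)
    (h : ∀ (a b : ℤ) (i j : Fin n), a * u i + b * u j ≤ 0 → a * r i + b * r j ≤ 0)
    (i j : Fin n) : r i * u j ≤ r j * u i := by
  by_contra! hlt
  have hδ : 0 < r i - r j * (u i / u j) := by
    rw [sub_pos, ← mul_div_assoc, div_lt_iff₀ (hu j)]
    exact hlt
  obtain ⟨q, hq1, hq2⟩ := exists_rat_btwn (lt_add_of_pos_right (u i / u j) hδ)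
  have hden : (0 : ℝ) < q.den := by exact_mod_cast q.den_pos
  have hq : (q : ℝ) * q.den = q.num := by exact_mod_cast Rat.mul_den_eq_num q
  have hle : u i ≤ q * u j := ((div_lt_iff₀ (hu j)).1 hq1).le
  have h' := h q.den (-q.num) i j (by
    push_cast
    rw [← hq]
    nlinarith)
  push_cast at h'
  rw [← hq] at h'
  have h1 : r i ≤ q * r j := by
    by_contra! hc
    nlinarith
  have h2 : r j * (q - u i / u j) ≤ q - u i / u j :=
    mul_le_of_le_one_left (sub_nonneg.2 hq1.le) (hr j).2
  linarith

/-- The eigenline segment is spanned by one of its points, all of whose coordinates are positive. -/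
lemma exists_spanning_point {n : ℕ} (hn : 1 ≤ n) {L : Matrix (Fin n) (Fin n) ℤ} {l : ℝ}
    {v : Fin n → ℝ} (hdim : eigSet L l = Set.range (fun c : ℝ => c • v))
    (hint : (eigSet L l ∩ interior (cube n)).Nonempty) :
    ∃ u ∈ eigSet L l ∩ halfCube n, (∀ i, 0 < u i) ∧
      ∀ x ∈ eigSet L l ∩ halfCube n, ∃ t ∈ Set.Icc (0 : ℝ) 1, x = t • u := by
  obtain ⟨w, hwE, hwI⟩ := hint
  have hw : ∀ i, 0 < w i := by
    rw [cube, ← Set.pi_univ_Icc, interior_pi_set Set.finite_univ] at hwI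
    intro i
    have hi : w i ∈ interior (Set.Icc (0 : ℝ) 1) := hwI i trivial
    rw [interior_Icc] at hi
    exact hi.1
  have : Nonempty (Fin n) := ⟨⟨0, hn⟩⟩
  obtain ⟨i₀, hi₀⟩ := Finite.exists_max w
  have h₀ := hw i₀
  have hu0 : ∀ i, 0 < ((2 * w i₀)⁻¹ • w) i := fun i => by
    have := hw i
    simp only [Pi.smul_apply, smul_eq_mul]
    positivity
  have hu₀ : ((2 * w i₀)⁻¹ • w) i₀ = 1 / 2 := by
    simp only [Pi.smul_apply, smul_eq_mul]
    field_simp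
  rw [hdim] at hwE
  obtain ⟨c, hc⟩ := hwE
  simp only at hc
  have hc0 : c ≠ 0 := by
    rintro rfl
    rw [zero_smul] at hc
    exact h₀.ne (congrFun hc i₀)
  refine ⟨(2 * w i₀)⁻¹ • w, ⟨?_, fun i => (hu0 i).le, fun i => ?_⟩, hu0, ?_⟩
  · rw [hdim, ← hc]
    exact ⟨(2 * (c • v) i₀)⁻¹ * c, by simp only [mul_smul]⟩
  · simp only [Pi.smul_apply, smul_eq_mul]
    rw [inv_mul_le_iff₀ (by positivity)]
    linarith [hi₀ i]
  · rintro x ⟨hxE, hx0, hx1⟩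
    rw [hdim] at hxE
    obtain ⟨b, hb⟩ := hxE
    simp only at hb
    have hx : x = (b * c⁻¹ * (2 * w i₀)) • ((2 * w i₀)⁻¹ • w) := by
      rw [smul_smul, mul_assoc, mul_inv_cancel₀ (by positivity : (2 * w i₀) ≠ 0), mul_one, ← hc,
        smul_smul, mul_assoc, inv_mul_cancel₀ hc0, mul_one, hb]
    refine ⟨_, ?_, hx⟩
    have h1 : x i₀ = (b * c⁻¹ * (2 * w i₀)) * (1 / 2) := by
      conv_lhs => rw [hx]
      rw [Pi.smul_apply, hu₀, smul_eq_mul]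
    have h2 := hx0 i₀
    have h3 := hx1 i₀
    rw [h1] at h2 h3
    simp only [Pi.zero_apply] at h2
    constructor <;> linarith

lemma halfCube_subset_cube (n : ℕ) : halfCube n ⊆ cube n := fun x hx =>
  ⟨hx.1, fun i => (hx.2 i).trans (by norm_num)⟩

lemma smul_mem_eigSet_inter_halfCube {n : ℕ} {L : Matrix (Fin n) (Fin n) ℤ} {l : ℝ}
    (hl0 : 0 ≤ l) (hl1 : l ≤ 1) {x : Fin n → ℝ} (hx : x ∈ eigSet L l ∩ halfCube n) :
    l • x ∈ eigSet L l ∩ halfCube n := by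
  obtain ⟨hE, h0, h1⟩ := hx
  refine ⟨?_, fun i => mul_nonneg hl0 (h0 i), fun i => ?_⟩
  · change (L.map ((↑) : ℤ → ℝ)).mulVec (l • x) = l • l • x
    rw [Matrix.mulVec_smul, hE]
  · exact (mul_le_of_le_one_left (h0 i) hl1).trans (h1 i)

lemma inv_mulVec_smul_of_mem_eigSet {n : ℕ} {L : Matrix (Fin n) (Fin n) ℤ} (hL : IsUnit L.det)
    {l : ℝ} {x : Fin n → ℝ} (hx : x ∈ eigSet L l) :
    (L⁻¹.map ((↑) : ℤ → ℝ)).mulVec (l • x) = x := by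
  have hx' : (L.map ((↑) : ℤ → ℝ)).mulVec x = l • x := hx
  have h : L⁻¹.map ((↑) : ℤ → ℝ) * L.map ((↑) : ℤ → ℝ) = 1 := by
    change L⁻¹.map (Int.castRingHom ℝ) * L.map (Int.castRingHom ℝ) = 1
    rw [← Matrix.map_mul, Matrix.nonsing_inv_mul L hL]
    exact Matrix.map_one _ (map_zero _) (map_one _)
  rw [← hx', Matrix.mulVec_mulVec, h, Matrix.one_mulVec]

/-- Every homomorphism from `McN (E ∩ [0,1/2]^n)` to a finite chain kills the coordinates. -/
lemma IsMVCharacter.map_eval_eq_zero {n : ℕ} (hn : 1 ≤ n) {L : Matrix (Fin n) (Fin n) ℤ} {l : ℝ}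
    (hl0 : 0 < l) (hl1 : l < 1) {u : Fin n → ℝ} (huE : u ∈ eigSet L l) (hu : ∀ i, 0 < u i)
    {X : Set (Fin n → ℝ)} (hX : X ⊆ cube n)
    (hspan : ∀ x ∈ X, ∃ t ∈ Set.Icc (0 : ℝ) 1, x = t • u)
    {ρ : (X → ℝ) → ℝ} (hρ : IsMVCharacter ρ) {d : ℕ} (hd : 1 ≤ d)
    (hC : ∀ h ∈ McN X, ρ h ∈ Cchain d) (i : Fin n) : ρ (fun x => x.1 i) = 0 := by
  set r : Fin n → ℝ := fun i => ρ (fun x => x.1 i) with hrdef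
  have hr : ∀ i, r i ∈ Set.Icc (0 : ℝ) 1 := fun i => hρ.mem_Icc _ (eval_mem_McN hX i)
  have hineq : ∀ (a b : ℤ) (i j : Fin n), a * u i + b * u j ≤ 0 → a * r i + b * r j ≤ 0 := by
    intro a b i j hab
    have hS := (((hρ.sendsTruncations_zero.add_zsmul hρ hX (eval_mem_McN hX i) a).add_zsmul hρ hX
      (eval_mem_McN hX j) b) 0).2
    have hzero : (fun x : X => unitClamp (0 + a * x.1 i + b * x.1 j + (0 : ℤ))) = fun _ => 0 := by
      funext x
      obtain ⟨t, ht, hx⟩ := hspan x.1 x.2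
      rw [unitClamp_eq_zero_iff, hx]
      simp only [Pi.smul_apply, smul_eq_mul, Int.cast_zero]
      nlinarith [mul_nonneg ht.1 (sub_nonneg.2 hab)]
    rw [hzero, hρ.map_zero] at hS
    simpa using unitClamp_eq_zero_iff.1 hS.symm
  have hpar : r = (r ⟨0, hn⟩ / u ⟨0, hn⟩) • u := by
    funext j
    have h := le_antisymm (mul_le_mul_of_int_inequalities hu hr hineq j ⟨0, hn⟩)
      (mul_le_mul_of_int_inequalities hu hr hineq ⟨0, hn⟩ j)
    have := (hu ⟨0, hn⟩).ne'
    rw [Pi.smul_apply, smul_eq_mul]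
    field_simp
    exact h
  have hrE : r ∈ eigSet L l := by
    rw [hpar]
    have hu' : (L.map ((↑) : ℤ → ℝ)).mulVec u = l • u := huE
    change (L.map ((↑) : ℤ → ℝ)).mulVec (_ • u) = l • (_ • u)
    rw [Matrix.mulVec_smul, hu', smul_comm]
  have hd0 : (d : ℝ) ≠ 0 := by
    have : d ≠ 0 := by omega
    exact_mod_cast this
  have hr0 : r = 0 := eq_zero_of_mem_eigSet_of_int hl0 hl1 hrE hd0 fun i => by
    obtain ⟨k, _, hk⟩ := hC _ (eval_mem_McN hX i)
    refine ⟨k, ?_⟩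
    change (d : ℝ) * ρ (fun x => x.1 i) = _
    rw [hk]
    push_cast
    field_simp
  exact congrFun hr0 i

lemma Cchain_subset_Icc (d : ℕ) : Cchain d ⊆ Set.Icc (0 : ℝ) 1 := by
  rintro _ ⟨k, hk, rfl⟩
  exact ⟨by positivity, div_le_one_of_le₀ (by exact_mod_cast hk) (by positivity)⟩

/-- if `L` is an `n × n` integer matrix with determinant `±1` having a
one-dimensional eigenspace `E` with eigenvalue `0 < λ < 1`, and `E` meets the interior of
`[0,1]^n`, then for `E' = E ∩ [0,1/2]^n` the MV-algebra `McN(E')` is not residually finite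
and not hopfian: it admits a surjective MV-endomorphism which is not injective. -/
theorem stmt13 {n : ℕ} (hn : 1 ≤ n) (L : Matrix (Fin n) (Fin n) ℤ)
    (hdet : L.det = 1 ∨ L.det = -1) (l : ℝ) (hl0 : 0 < l) (hl1 : l < 1)
    (v : Fin n → ℝ) (hv : v ≠ 0)
    (hdim : eigSet L l = Set.range (fun c : ℝ => c • v))
    (hint : (eigSet L l ∩ interior (cube n)).Nonempty) :
    ¬ ResiduallyFinite (eigSet L l ∩ halfCube n) ∧
    ∃ σ : (↥(eigSet L l ∩ halfCube n) → ℝ) → (↥(eigSet L l ∩ halfCube n) → ℝ),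
      IsMVEndo (eigSet L l ∩ halfCube n) σ ∧
      Set.SurjOn σ (McN (eigSet L l ∩ halfCube n)) (McN (eigSet L l ∩ halfCube n)) ∧
      ¬ Set.InjOn σ (McN (eigSet L l ∩ halfCube n)) := by
  obtain ⟨u, huX, hu, hspan⟩ := exists_spanning_point hn hdim hint
  set X := eigSet L l ∩ halfCube n with hXdef
  have hX : X ⊆ cube n := fun x hx => halfCube_subset_cube n hx.2
  have hL : IsUnit L.det := Int.isUnit_iff.2 hdet
  have hu₀ := hu ⟨0, hn⟩
  have hgap : 0 < u ⟨0, hn⟩ * (1 - l) := mul_pos hu₀ (sub_pos.2 hl1)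
  obtain ⟨k, hk⟩ := exists_nat_gt (1 / (u ⟨0, hn⟩ * (1 - l)))
  rw [div_lt_iff₀ hgap] at hk
  set p : ℤ := ⌈(k : ℝ) * (l * u ⟨0, hn⟩)⌉ with hp
  have hpl : (k : ℝ) * (l * u ⟨0, hn⟩) ≤ p := Int.le_ceil _
  have hpu : (p : ℝ) < k * u ⟨0, hn⟩ := by
    have := Int.ceil_lt_add_one ((k : ℝ) * (l * u ⟨0, hn⟩))
    rw [← hp] at this
    linarith
  have hp0 : (0 : ℝ) ≤ p := le_trans (by positivity) hpl
  set f : X → ℝ := fun x => unitClamp (0 + ((k : ℤ) : ℝ) * x.1 ⟨0, hn⟩ + ((-p : ℤ) : ℝ)) with hf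
  have hfM : f ∈ McN X := by
    have h := (((isAffineZ_const (n := n) 0).add ((isAffineZ_eval ⟨0, hn⟩).const_mul k)).add
      (isAffineZ_const (-p))).unitClamp_mem_McN (X := X)
    simpa only [Int.cast_zero] using h
  have hfne : f ≠ fun _ => 0 := by
    intro h
    have := unitClamp_eq_zero_iff.1 (congrFun h ⟨u, huX⟩)
    push_cast at this
    linarith
  have hmaps : ∀ x : X, l • x.1 ∈ X := fun x =>
    smul_mem_eigSet_inter_halfCube hl0.le hl1.le x.2
  refine ⟨fun hres => ?_, fun g x => g ⟨l • x.1, hmaps x⟩,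
    ⟨?_, rfl, fun _ _ => rfl, fun _ _ _ _ => rfl⟩, ?_, ?_⟩
  · obtain ⟨d, hd, ρ, hC, h0, hneg, hplus, hsep⟩ := hres f hfM _ zero_mem_McN hfne
    have hρ : IsMVCharacter ρ :=
      ⟨fun h hh => Cchain_subset_Icc d (hC h hh), h0, hneg, hplus⟩
    have hr := hρ.map_eval_eq_zero hn hl0 hl1 huX.1 hu hX hspan hd hC ⟨0, hn⟩
    have hS := ((hρ.sendsTruncations_zero.add_zsmul hρ hX (eval_mem_McN hX ⟨0, hn⟩) k) (-p)).2
    rw [hr] at hS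
    refine hsep (hS.trans ?_)
    rw [h0, unitClamp_eq_zero_iff]
    push_cast
    linarith
  · rintro g ⟨F, hF, h⟩
    refine ⟨_, hF.comp_matrix L, fun x => ?_⟩
    have hx : (L.map ((↑) : ℤ → ℝ)).mulVec x.1 = l • x.1 := x.2.1
    have hmem := hX (hmaps x)
    simp only [h, hx]
    exact congrArg F (funext fun i => (unitClamp_of_mem ⟨hmem.1 i, hmem.2 i⟩).symm)
  · rintro g ⟨F, hF, h⟩
    refine ⟨fun x => F fun i => unitClamp ((L⁻¹.map ((↑) : ℤ → ℝ)).mulVec x.1 i),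
      ⟨_, hF.comp_matrix L⁻¹, fun x => rfl⟩, ?_⟩
    funext x
    have hmem := hX x.2
    simp only [h, inv_mulVec_smul_of_mem_eigSet hL x.2.1]
    exact congrArg F (funext fun i => unitClamp_of_mem ⟨hmem.1 i, hmem.2 i⟩)
  · intro hinj
    refine hfne (hinj hfM zero_mem_McN ?_)
    funext x
    obtain ⟨t, ht, hx⟩ := hspan x.1 x.2
    simp only [hf]
    rw [unitClamp_eq_zero_iff, hx]
    have h1 : (k : ℝ) * (l * (t * u ⟨0, hn⟩)) ≤ k * (l * u ⟨0, hn⟩) := by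
      have := mul_le_of_le_one_left hu₀.le ht.2
      gcongr
    simp only [Pi.smul_apply, smul_eq_mul]
    push_cast
    linarith
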